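/- Let F : ℝ³ × ℝ³ ≅ ℝ⁶ → ℝ be F(x, y) = (‖x‖² + ‖y‖²)² − 2·((‖x‖² − ‖y‖²)² + 4·⟨x, y⟩²), and let Φ := (1/4)·∇F : ℝ⁶ → ℝ⁶ be its gradient map (whose components are harmonic homogeneous cubic polynomials and which maps S⁵ to S⁵). Let h : (0, ∞) → ℝ be a C², strictly increasing function with lim_{r→0⁺} h(r) = 0 and lim_{r→∞} h(r) = 1, satisfying −h''(r) − 5·h'(r)/r + 21·h(r)/r² = h(r)·(1 − h(r)²) for all r > 0. Define u : ℝ⁶ → ℝ⁶ by u(x) = h(‖x‖)·Φ(x/‖x‖) for x ≠ 0 and u(0) = 0. Then: (i) u solves the Ginzburg–Landau system Δu = u·(‖u‖² − 1) on ℝ⁶ \ {0}; (ii) ‖u(x)‖ = h(‖x‖) < 1 for all x ≠ 0, so ‖u(x)‖ → 1 as ‖x‖ → ∞; and (iii) u does NOT have the Brézis form modulo translation and isometry: there exist no b ∈ ℝ⁶, no linear isometry R : ℝ⁶ → ℝ⁶, and no function h̃ : (0, ∞) → [0, ∞) such that u(x) = h̃(‖x − b‖)·R((x − b)/‖x − b‖)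 for all x ≠ b. -/

import Mathlib

/-- The Euclidean Laplacian of a function on a finite-dimensional real inner product space,
computed as the sum of second derivatives along an orthonormal basis. -/
noncomputable def laplacian {E : Type*} [NormedAddCommGroup E] [InnerProductSpace ℝ E]
    [FiniteDimensional ℝ E] (f : E → ℝ) (x : E) : ℝ :=
  ∑ i, iteratedFDeriv ℝ 2 f x ![stdOrthonormalBasis ℝ E i, stdOrthonormalBasis ℝ E i]

/-- Identifying `ℝ³ × ℝ³ ≅ ℝ⁶` via `p = (x, y)` with `x = (p 0, p 1, p 2)` and
`y = (p 3, p 4, p 5)`: the squared norm `‖x‖²`. -/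
def normSqX (p : EuclideanSpace ℝ (Fin 6)) : ℝ := p 0 ^ 2 + p 1 ^ 2 + p 2 ^ 2

/-- The squared norm `‖y‖²` of the second `ℝ³`-factor. -/
def normSqY (p : EuclideanSpace ℝ (Fin 6)) : ℝ := p 3 ^ 2 + p 4 ^ 2 + p 5 ^ 2

/-- The Euclidean inner product `⟨x, y⟩` of the two `ℝ³`-factors. -/
def innXY (p : EuclideanSpace ℝ (Fin 6)) : ℝ := p 0 * p 3 + p 1 * p 4 + p 2 * p 5

/-- The Cartan–Münzner polynomial
`F(x, y) = (‖x‖² + ‖y‖²)² - 2((‖x‖² - ‖y‖²)² + 4⟨x, y⟩²)` on `ℝ³ × ℝ³ ≅ ℝ⁶`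
(the isoparametric polynomial with `g = 4`, `m₁ = m₂ = 1`). -/
def isoparamF (p : EuclideanSpace ℝ (Fin 6)) : ℝ :=
  (normSqX p + normSqY p) ^ 2 - 2 * ((normSqX p - normSqY p) ^ 2 + 4 * innXY p ^ 2)

/-- The gradient map `Φ = (1/4) ∇F` of the isoparametric polynomial `isoparamF`. -/
noncomputable def gradMapF (p : EuclideanSpace ℝ (Fin 6)) : EuclideanSpace ℝ (Fin 6) :=
  (4 : ℝ)⁻¹ • gradient isoparamF p

open Filter Topology

section Laplacian

variable {E : Type*} [NormedAddCommGroup E] [InnerProductSpace ℝ E]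

theorem hasDerivAt_add_smul (x v : E) (t : ℝ) : HasDerivAt (fun s : ℝ => x + s • v) v t := by
  simpa using ((hasDerivAt_id t).smul_const v).const_add x

/-- A `C²` function restricted to a line is twice differentiable, with second derivative given by
the second Fréchet derivative. -/
theorem ContDiffAt.hasDerivAt_line {f : E → ℝ} {x : E} (hf : ContDiffAt ℝ 2 f x) (v : E) :
    (∀ᶠ t : ℝ in 𝓝 0, HasDerivAt (fun t : ℝ => f (x + t • v)) (fderiv ℝ f (x + t • v) v) t) ∧
      HasDerivAt (fun t : ℝ => fderiv ℝ f (x + t • v) v) (iteratedFDeriv ℝ 2 f x ![v, v]) 0 := by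
  have hline : Tendsto (fun t : ℝ => x + t • v) (𝓝 0) (𝓝 x) := by
    simpa using (hasDerivAt_add_smul x v 0).continuousAt.tendsto
  constructor
  · have h2 : ∀ᶠ y in 𝓝 x, DifferentiableAt ℝ f y :=
      (hf.eventually (by simp)).mono fun y hy => hy.differentiableAt (by simp)
    filter_upwards [hline.eventually h2] with t ht
    exact ht.hasFDerivAt.comp_hasDerivAt t (hasDerivAt_add_smul x v t)
  · have h1 : DifferentiableAt ℝ (fderiv ℝ f) x :=
      (hf.fderiv_right (m := 1) (by norm_num)).differentiableAt (by simp)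
    have h2 : HasFDerivAt (fderiv ℝ f) (fderiv ℝ (fderiv ℝ f) x) (x + (0 : ℝ) • v) := by
      simpa using h1.hasFDerivAt
    have h3 := h2.comp_hasDerivAt (0 : ℝ) (hasDerivAt_add_smul x v 0)
    simpa [iteratedFDeriv_two_apply] using h3.clm_apply (hasDerivAt_const (0 : ℝ) v)

/-- The second derivative of a `C²` function in a given direction can be computed along a line. -/
theorem ContDiffAt.iteratedFDeriv_two_eq_of_hasDerivAt {f : E → ℝ} {x v : E} {g : ℝ → ℝ} {c : ℝ}
    (hf : ContDiffAt ℝ 2 f x)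
    (hg : ∀ᶠ t : ℝ in 𝓝 0, HasDerivAt (fun t : ℝ => f (x + t • v)) (g t) t)
    (hc : HasDerivAt g c 0) :
    iteratedFDeriv ℝ 2 f x ![v, v] = c := by
  obtain ⟨h1, h2⟩ := hf.hasDerivAt_line v
  refine h2.unique (hc.congr_of_eventuallyEq ?_)
  filter_upwards [h1, hg] with t ht ht' using ht.unique ht'

theorem hasDerivAt_norm_sq_line (x v : E) (t : ℝ) :
    HasDerivAt (fun s : ℝ => ‖x + s • v‖ ^ 2) (2 * inner ℝ (x + t • v) v) t :=
  (hasDerivAt_add_smul x v t).norm_sq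

theorem hasDerivAt_inner_line (x v : E) (t : ℝ) :
    HasDerivAt (fun s : ℝ => inner ℝ (x + s • v) v) (‖v‖ ^ 2) t := by
  simpa using (hasDerivAt_add_smul x v t).inner ℝ (hasDerivAt_const t v)

theorem iteratedFDeriv_two_radial_mul {k k₁ : ℝ → ℝ} {k₂ : ℝ} {P : E → ℝ} {x : E} (v : E)
    (hk : ContDiffAt ℝ 2 k (‖x‖ ^ 2)) (hk₁ : ∀ᶠ s in 𝓝 (‖x‖ ^ 2), HasDerivAt k (k₁ s) s)
    (hk₂ : HasDerivAt k₁ k₂ (‖x‖ ^ 2)) (hP : ContDiffAt ℝ 2 P x) :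
    iteratedFDeriv ℝ 2 (fun y => k (‖y‖ ^ 2) * P y) x ![v, v] =
      4 * k₂ * P x * inner ℝ x v ^ 2 + 2 * k₁ (‖x‖ ^ 2) * P x * ‖v‖ ^ 2 +
        4 * k₁ (‖x‖ ^ 2) * (inner ℝ x v * fderiv ℝ P x v) +
        k (‖x‖ ^ 2) * iteratedFDeriv ℝ 2 P x ![v, v] := by
  obtain ⟨hP₁, hP₂⟩ := hP.hasDerivAt_line v
  have hq : Tendsto (fun t : ℝ => ‖x + t • v‖ ^ 2) (𝓝 0) (𝓝 (‖x‖ ^ 2)) := by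
    simpa using (hasDerivAt_norm_sq_line x v 0).continuousAt.tendsto
  have hcd : ContDiffAt ℝ 2 (fun y => k (‖y‖ ^ 2) * P y) x :=
    (hk.comp x (contDiff_norm_sq ℝ).contDiffAt).mul hP
  refine hcd.iteratedFDeriv_two_eq_of_hasDerivAt
    (g := fun t => k₁ (‖x + t • v‖ ^ 2) * (2 * inner ℝ (x + t • v) v) * P (x + t • v) +
      k (‖x + t • v‖ ^ 2) * fderiv ℝ P (x + t • v) v) ?_ ?_
  · filter_upwards [hP₁, hq.eventually hk₁] with t ht hkt
    exact (hkt.comp t (hasDerivAt_norm_sq_line x v t)).mul ht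
  · have hk₁' : HasDerivAt k (k₁ (‖x‖ ^ 2)) (‖x + (0 : ℝ) • v‖ ^ 2) := by
      simpa using hk₁.self_of_nhds
    have hk₂' : HasDerivAt k₁ k₂ (‖x + (0 : ℝ) • v‖ ^ 2) := by simpa using hk₂
    have hq' := hasDerivAt_norm_sq_line x v 0
    have := (((hk₂'.comp (0 : ℝ) hq').mul ((hasDerivAt_inner_line x v 0).const_mul 2)).mul
      hP₁.self_of_nhds).add ((hk₁'.comp (0 : ℝ) hq').mul hP₂)
    refine this.congr_deriv ?_
    simp
    ring

variable [FiniteDimensional ℝ E]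

theorem laplacian_congr {f g : E → ℝ} {x : E} (hfg : f =ᶠ[𝓝 x] g) :
    laplacian f x = laplacian g x := by
  simp only [laplacian, (hfg.iteratedFDeriv ℝ 2).self_of_nhds]

theorem laplacian_eq_sum_orthonormalBasis {ι : Type*} [Fintype ι] (b : OrthonormalBasis ι ℝ E)
    (f : E → ℝ) (x : E) : laplacian f x = ∑ i, iteratedFDeriv ℝ 2 f x ![b i, b i] := by
  have h₁ := congrFun (InnerProductSpace.laplacian_eq_iteratedFDeriv_stdOrthonormalBasis f) x
  have h₂ := congrFun (InnerProductSpace.laplacian_eq_iteratedFDeriv_orthonormalBasis f b) x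
  exact h₁.symm.trans h₂

/-- The Laplacian of a product of a radial function with a homogeneous function of degree `d`
(the latter assumption entering only through Euler's identity). -/
theorem laplacian_radial_mul {k k₁ : ℝ → ℝ} {k₂ d : ℝ} {P : E → ℝ} {x : E}
    (hk : ContDiffAt ℝ 2 k (‖x‖ ^ 2)) (hk₁ : ∀ᶠ s in 𝓝 (‖x‖ ^ 2), HasDerivAt k (k₁ s) s)
    (hk₂ : HasDerivAt k₁ k₂ (‖x‖ ^ 2)) (hP : ContDiffAt ℝ 2 P x)
    (hd : fderiv ℝ P x x = d * P x) :
    laplacian (fun y => k (‖y‖ ^ 2) * P y) x =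
      (4 * ‖x‖ ^ 2 * k₂ + (2 * Module.finrank ℝ E + 4 * d) * k₁ (‖x‖ ^ 2)) * P x +
        k (‖x‖ ^ 2) * laplacian P x := by
  set e := stdOrthonormalBasis ℝ E
  have hsum : ∑ i, inner ℝ x (e i) * fderiv ℝ P x (e i) = d * P x := by
    rw [← hd]
    simpa [real_inner_comm] using congrArg (fderiv ℝ P x) (e.sum_repr' x)
  simp only [laplacian, iteratedFDeriv_two_radial_mul _ hk hk₁ hk₂ hP]
  simp only [Finset.sum_add_distrib, ← Finset.mul_sum]
  rw [e.sum_sq_inner_left, hsum]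
  simp
  ring

end Laplacian

theorem iteratedFDeriv_two_eq_of_cubic {E : Type*} [NormedAddCommGroup E] [InnerProductSpace ℝ E]
    {f : E → ℝ} {x v : E} (hf : ContDiffAt ℝ 2 f x) {a b c d : ℝ}
    (h : ∀ t : ℝ, f (x + t • v) = a + b * t + c * t ^ 2 + d * t ^ 3) :
    iteratedFDeriv ℝ 2 f x ![v, v] = 2 * c := by
  refine hf.iteratedFDeriv_two_eq_of_hasDerivAt (g := fun t => b + 2 * c * t + 3 * d * t ^ 2) ?_ ?_
  · refine Eventually.of_forall fun t => ?_
    simp only [h]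
    refine (((((hasDerivAt_id t).const_mul b).const_add a).add
      (((hasDerivAt_id t).pow 2).const_mul c)).add
      (((hasDerivAt_id t).pow 3).const_mul d)).congr_deriv ?_
    simp
    ring
  · refine ((((hasDerivAt_id (0 : ℝ)).const_mul (2 * c)).const_add b).add
      (((hasDerivAt_id (0 : ℝ)).pow 2).const_mul (3 * d))).congr_deriv ?_
    simp

section IsoparametricMap

theorem gradMapF_eq (p : EuclideanSpace ℝ (Fin 6)) :
    gradMapF p =
      !₂[(3 * normSqY p - normSqX p) * p 0 - 4 * innXY p * p 3,
        (3 * normSqY p - normSqX p) * p 1 - 4 * innXY p * p 4,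
        (3 * normSqY p - normSqX p) * p 2 - 4 * innXY p * p 5,
        (3 * normSqX p - normSqY p) * p 3 - 4 * innXY p * p 0,
        (3 * normSqX p - normSqY p) * p 4 - 4 * innXY p * p 1,
        (3 * normSqX p - normSqY p) * p 5 - 4 * innXY p * p 2] := by
  have hc (i : Fin 6) : HasFDerivAt (fun q : EuclideanSpace ℝ (Fin 6) => q i)
      (EuclideanSpace.proj i : EuclideanSpace ℝ (Fin 6) →L[ℝ] ℝ) p :=
    (EuclideanSpace.proj i : EuclideanSpace ℝ (Fin 6) →L[ℝ] ℝ).hasFDerivAt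
  have hX := (((hc 0).pow 2).add ((hc 1).pow 2)).add ((hc 2).pow 2)
  have hY := (((hc 3).pow 2).add ((hc 4).pow 2)).add ((hc 5).pow 2)
  have hI := (((hc 0).mul (hc 3)).add ((hc 1).mul (hc 4))).add ((hc 2).mul (hc 5))
  have hF := ((hX.add hY).pow 2).sub
    ((((hX.sub hY).pow 2).add ((hI.pow 2).const_mul 4)).const_mul 2)
  have hg : HasGradientAt isoparamF ((4 : ℝ) •
      !₂[(3 * normSqY p - normSqX p) * p 0 - 4 * innXY p * p 3,
        (3 * normSqY p - normSqX p) * p 1 - 4 * innXY p * p 4,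
        (3 * normSqY p - normSqX p) * p 2 - 4 * innXY p * p 5,
        (3 * normSqX p - normSqY p) * p 3 - 4 * innXY p * p 0,
        (3 * normSqX p - normSqY p) * p 4 - 4 * innXY p * p 1,
        (3 * normSqX p - normSqY p) * p 5 - 4 * innXY p * p 2]) p := by
    rw [hasGradientAt_iff_hasFDerivAt]
    refine HasFDerivAt.congr_fderiv hF ?_
    ext v
    simp [PiLp.inner_apply, Fin.sum_univ_six, normSqX, normSqY, innXY]
    ring
  rw [gradMapF, hg.gradient, smul_smul]
  norm_num

theorem norm_sq_eq_normSqX_add_normSqY (p : EuclideanSpace ℝ (Fin 6)) :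
    ‖p‖ ^ 2 = normSqX p + normSqY p := by
  simp [EuclideanSpace.norm_sq_eq, Fin.sum_univ_six, normSqX, normSqY]
  ring

theorem norm_gradMapF (p : EuclideanSpace ℝ (Fin 6)) : ‖gradMapF p‖ = ‖p‖ ^ 3 := by
  rw [← pow_left_inj₀ (norm_nonneg _) (by positivity) two_ne_zero, ← pow_mul, mul_comm 3 2,
    pow_mul, norm_sq_eq_normSqX_add_normSqY p, norm_sq_eq_normSqX_add_normSqY, gradMapF_eq]
  simp [normSqX, normSqY, innXY]
  ring

theorem gradMapF_smul (c : ℝ) (p : EuclideanSpace ℝ (Fin 6)) :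
    gradMapF (c • p) = c ^ 3 • gradMapF p := by
  ext i
  fin_cases i <;> simp [gradMapF_eq, normSqX, normSqY, innXY] <;> ring

theorem contDiff_gradMapF_apply (i : Fin 6) : ContDiff ℝ 2 fun p => gradMapF p i := by
  fin_cases i <;> simp [gradMapF_eq, normSqX, normSqY, innXY] <;> fun_prop

theorem fderiv_gradMapF_apply_self (i : Fin 6) (x : EuclideanSpace ℝ (Fin 6)) :
    fderiv ℝ (fun p => gradMapF p i) x x = 3 * gradMapF x i := by
  have h₁ : HasFDerivAt (fun p => gradMapF p i) (fderiv ℝ (fun p => gradMapF p i) x)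
      (0 + (1 : ℝ) • x) := by
    simpa using ((contDiff_gradMapF_apply i).differentiable (by simp) x).hasFDerivAt
  have h₂ := h₁.comp_hasDerivAt (1 : ℝ) (hasDerivAt_add_smul 0 x 1)
  refine h₂.unique ?_
  simpa [Function.comp_def, gradMapF_smul] using
    ((hasDerivAt_id (1 : ℝ)).pow 3).mul_const (gradMapF x i)

theorem gradMapF_add_smul (x v : EuclideanSpace ℝ (Fin 6)) (t : ℝ) (i : Fin 6) :
    gradMapF (x + t • v) i = gradMapF x i +
      ((gradMapF (x + v) i - gradMapF (x - v) i) / 2 - gradMapF v i) * t +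
      ((gradMapF (x + v) i + gradMapF (x - v) i) / 2 - gradMapF x i) * t ^ 2 +
      gradMapF v i * t ^ 3 := by
  fin_cases i <;> simp [gradMapF_eq, normSqX, normSqY, innXY] <;> ring

theorem laplacian_gradMapF_apply (i : Fin 6) (x : EuclideanSpace ℝ (Fin 6)) :
    laplacian (fun p => gradMapF p i) x = 0 := by
  rw [laplacian_eq_sum_orthonormalBasis (EuclideanSpace.basisFun (Fin 6) ℝ)]
  simp only [iteratedFDeriv_two_eq_of_cubic (contDiff_gradMapF_apply i).contDiffAt
    (fun t => gradMapF_add_smul x _ t i)]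
  fin_cases i <;>
    simp [Fin.sum_univ_six, gradMapF_eq, normSqX, normSqY, innXY, PiLp.single_apply] <;>
    ring

end IsoparametricMap

section Profile

variable {h : ℝ → ℝ}

theorem StrictMonoOn.pos_of_tendsto_zero (hmono : StrictMonoOn h (Set.Ioi 0))
    (h0 : Tendsto h (𝓝[>] 0) (𝓝 0)) {r : ℝ} (hr : 0 < r) : 0 < h r := by
  have h2 : 0 < r / 2 := by positivity
  have h1 : 0 ≤ h (r / 2) := by
    refine le_of_tendsto h0 ?_
    filter_upwards [Ioo_mem_nhdsGT h2] with s hs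
    exact (hmono hs.1 h2 hs.2).le
  exact h1.trans_lt (hmono h2 hr (by linarith))

theorem StrictMonoOn.lt_one_of_tendsto_one (hmono : StrictMonoOn h (Set.Ioi 0))
    (hinf : Tendsto h atTop (𝓝 1)) {r : ℝ} (hr : 0 < r) : h r < 1 := by
  have h2 : 0 < r + 1 := by positivity
  refine (hmono hr h2 (by linarith)).trans_le (ge_of_tendsto hinf ?_)
  filter_upwards [eventually_ge_atTop (r + 1)] with s hs
  exact hmono.monotoneOn h2 (h2.trans_le hs) hs

theorem contDiffAt_comp_sqrt_div (hC2 : ContDiffOn ℝ 2 h (Set.Ioi 0)) {s : ℝ} (hs : 0 < s) :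
    ContDiffAt ℝ 2 (fun s => h √s / √s ^ 3) s := by
  have hs' : 0 < √s := Real.sqrt_pos.2 hs
  have h1 : ContDiffAt ℝ 2 Real.sqrt s := Real.contDiffAt_sqrt hs.ne'
  exact ((hC2.contDiffAt (Ioi_mem_nhds hs')).comp s h1).div (h1.pow 3) (by positivity)

theorem hasDerivAt_comp_sqrt_div {s h' : ℝ} (hs : 0 < s) (hh : HasDerivAt h h' √s) :
    HasDerivAt (fun s => h √s / √s ^ 3) (h' / (2 * √s ^ 4) - 3 * h √s / (2 * √s ^ 5)) s := by
  have hs' : 0 < √s := Real.sqrt_pos.2 hs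
  have h1 := Real.hasDerivAt_sqrt hs.ne'
  refine ((hh.comp s h1).div (h1.fun_pow 3) (by positivity)).congr_deriv ?_
  simp only [Function.comp_def]
  field_simp
  push_cast
  ring

theorem hasDerivAt_deriv_comp_sqrt_div {h' : ℝ → ℝ} {s h'' : ℝ} (hs : 0 < s)
    (hh : HasDerivAt h (h' √s) √s) (hh' : HasDerivAt h' h'' √s) :
    HasDerivAt (fun s => h' √s / (2 * √s ^ 4) - 3 * h √s / (2 * √s ^ 5))
      (h'' / (4 * √s ^ 5) - 7 * h' √s / (4 * √s ^ 6) +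
        15 * h √s / (4 * √s ^ 7)) s := by
  have hs' : 0 < √s := Real.sqrt_pos.2 hs
  have h1 := Real.hasDerivAt_sqrt hs.ne'
  refine (((hh'.comp s h1).div ((h1.fun_pow 4).const_mul 2) (by positivity)).sub
    (((hh.comp s h1).const_mul 3).div ((h1.fun_pow 5).const_mul 2) (by positivity))).congr_deriv ?_
  simp only [Function.comp_def]
  field_simp
  ring

end Profile

/-- **Theorem 1.2 of the paper.**  Let `Φ = (1/4) ∇F` be the gradient map of
the isoparametric polynomial `F` on `ℝ⁶` with `g = 4`, `m₁ = m₂ = 1`, and let `h` be the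
`C²`, strictly increasing profile with `h(0⁺) = 0`, `h(∞) = 1` solving
`-h'' - 5 h'/r + 21 h/r² = h (1 - h²)`.  Then `u(x) = h(‖x‖) Φ(x/‖x‖)` (with `u(0) = 0`)
(i) solves the Ginzburg–Landau system `Δu = u (‖u‖² - 1)` on `ℝ⁶ \ {0}`,
(ii) satisfies `‖u(x)‖ = h(‖x‖) < 1` for `x ≠ 0`, and `‖u(x)‖ → 1` as `‖x‖ → ∞`, and
(iii) does NOT have the Brézis form `u(x) = h̃(‖x - b‖) R((x - b)/‖x - b‖)` for any
translation `b`, linear isometry `R`, and profile `h̃ ≥ 0`. -/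
theorem ginzburgLandau_counterexample_dim6
    (h : ℝ → ℝ) (hC2 : ContDiffOn ℝ 2 h (Set.Ioi 0))
    (hmono : StrictMonoOn h (Set.Ioi 0))
    (h0 : Filter.Tendsto h (nhdsWithin 0 (Set.Ioi 0)) (nhds 0))
    (hinf : Filter.Tendsto h Filter.atTop (nhds 1))
    (hODE : ∀ r : ℝ, 0 < r →
      -(deriv (deriv h) r) - 5 * deriv h r / r + 21 * h r / r ^ 2 = h r * (1 - h r ^ 2))
    (u : EuclideanSpace ℝ (Fin 6) → EuclideanSpace ℝ (Fin 6))
    (hu0 : u 0 = 0)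
    (hu : ∀ x : EuclideanSpace ℝ (Fin 6), x ≠ 0 → u x = h ‖x‖ • gradMapF (‖x‖⁻¹ • x)) :
    (∀ x : EuclideanSpace ℝ (Fin 6), x ≠ 0 →
        ∀ i : Fin 6, laplacian (fun y => u y i) x = u x i * (‖u x‖ ^ 2 - 1)) ∧
      ((∀ x : EuclideanSpace ℝ (Fin 6), x ≠ 0 → ‖u x‖ = h ‖x‖ ∧ h ‖x‖ < 1) ∧
        Filter.Tendsto (fun x : EuclideanSpace ℝ (Fin 6) => ‖u x‖)
          (Bornology.cobounded (EuclideanSpace ℝ (Fin 6))) (nhds 1)) ∧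
      ¬∃ (b : EuclideanSpace ℝ (Fin 6))
          (R : EuclideanSpace ℝ (Fin 6) →ₗᵢ[ℝ] EuclideanSpace ℝ (Fin 6)) (ht : ℝ → ℝ),
          (∀ r : ℝ, 0 < r → 0 ≤ ht r) ∧
            ∀ x : EuclideanSpace ℝ (Fin 6), x ≠ b →
              u x = ht ‖x - b‖ • R (‖x - b‖⁻¹ • (x - b)) := by
  have hpos : ∀ r : ℝ, 0 < r → 0 < h r := fun r hr => hmono.pos_of_tendsto_zero h0 hr
  have hnorm : ∀ x : EuclideanSpace ℝ (Fin 6), x ≠ 0 → ‖u x‖ = h ‖x‖ := by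
    intro x hx
    have hx' : 0 < ‖x‖ := norm_pos_iff.2 hx
    rw [hu x hx, norm_smul, norm_gradMapF, norm_smul, norm_inv, norm_norm,
      inv_mul_cancel₀ hx'.ne', Real.norm_of_nonneg (hpos _ hx').le]
    simp
  refine ⟨fun x hx i => ?_, ⟨fun x hx => ⟨hnorm x hx,
    hmono.lt_one_of_tendsto_one hinf (norm_pos_iff.2 hx)⟩, ?_⟩, ?_⟩
  · have hx' : 0 < ‖x‖ := norm_pos_iff.2 hx
    have hx2 : 0 < ‖x‖ ^ 2 := by positivity
    have hd1 : ∀ r : ℝ, 0 < r → HasDerivAt h (deriv h r) r := fun r hr =>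
      ((hC2.contDiffAt (Ioi_mem_nhds hr)).differentiableAt (by simp)).hasDerivAt
    have hd2 : ∀ r : ℝ, 0 < r → HasDerivAt (deriv h) (deriv (deriv h) r) r := fun r hr =>
      (((hC2.deriv_of_isOpen (m := 1) isOpen_Ioi
        (by norm_num)).contDiffAt (Ioi_mem_nhds hr)).differentiableAt (by simp)).hasDerivAt
    have hux : ∀ y : EuclideanSpace ℝ (Fin 6), y ≠ 0 →
        u y i = h √(‖y‖ ^ 2) / √(‖y‖ ^ 2) ^ 3 * gradMapF y i := by
      intro y hy
      rw [hu y hy, gradMapF_smul, Real.sqrt_sq (norm_nonneg y)]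
      simp
      ring
    have hev : (fun y => u y i) =ᶠ[𝓝 x]
        fun y => (fun s => h √s / √s ^ 3) (‖y‖ ^ 2) * gradMapF y i := by
      filter_upwards [isOpen_ne.mem_nhds hx] with y hy using hux y hy
    have hk₁ : ∀ᶠ s in 𝓝 (‖x‖ ^ 2), HasDerivAt (fun s => h √s / √s ^ 3)
        (deriv h √s / (2 * √s ^ 4) - 3 * h √s / (2 * √s ^ 5)) s := by
      filter_upwards [Ioi_mem_nhds hx2] with s hs
      exact hasDerivAt_comp_sqrt_div hs (hd1 _ (Real.sqrt_pos.2 hs))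
    have hk₂ := hasDerivAt_deriv_comp_sqrt_div hx2 (hd1 _ (Real.sqrt_pos.2 hx2))
      (hd2 _ (Real.sqrt_pos.2 hx2))
    rw [laplacian_congr hev, laplacian_radial_mul (contDiffAt_comp_sqrt_div hC2 hx2) hk₁ hk₂
      (contDiff_gradMapF_apply i).contDiffAt (fderiv_gradMapF_apply_self i x),
      laplacian_gradMapF_apply, hnorm x hx, hux x hx, Real.sqrt_sq hx'.le]
    have hO := hODE _ hx'
    have hO' : deriv (deriv h) ‖x‖ =
        -5 * deriv h ‖x‖ / ‖x‖ + 21 * h ‖x‖ / ‖x‖ ^ 2 - h ‖x‖ * (1 - h ‖x‖ ^ 2) := by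
      linear_combination -hO
    rw [hO']
    simp only [finrank_euclideanSpace, Fintype.card_fin]
    field_simp
    ring
  · refine (hinf.comp tendsto_norm_cobounded_atTop).congr' ?_
    filter_upwards [Bornology.eventually_ne_cobounded 0] with x hx using (hnorm x hx).symm
  · rintro ⟨b, R, ht, -, hR⟩
    have hRnorm : ∀ x, x ≠ b → ‖u x‖ = |ht ‖x - b‖| := by
      intro x hx
      have : ‖x - b‖ ≠ 0 := norm_ne_zero_iff.2 (sub_ne_zero.2 hx)
      rw [hR x hx, norm_smul, R.norm_map, norm_smul, norm_inv, norm_norm, inv_mul_cancel₀ this,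
        mul_one, Real.norm_eq_abs]
    have hb : b = 0 := by
      by_contra hb
      have hb' : 0 < ‖b‖ := norm_pos_iff.2 hb
      have e₁ : (3 : ℝ) • b - b = (2 : ℝ) • b := by module
      have e₂ : -b - b = -((2 : ℝ) • b) := by module
      have h2 : (2 : ℝ) • b ≠ 0 := smul_ne_zero two_ne_zero hb
      have h3 : (3 : ℝ) • b ≠ 0 := smul_ne_zero three_ne_zero hb
      have n₁ := hRnorm ((3 : ℝ) • b) (sub_ne_zero.1 (by rwa [e₁]))
      have n₂ := hRnorm (-b) (sub_ne_zero.1 (by rw [e₂]; exact neg_ne_zero.2 h2))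
      rw [e₁, hnorm _ h3, norm_smul] at n₁
      rw [e₂, norm_neg, hnorm _ (neg_ne_zero.2 hb), norm_neg] at n₂
      have := hmono hb' (show 0 < ‖(3 : ℝ)‖ * ‖b‖ from mul_pos (by norm_num) hb')
        (by rw [Real.norm_of_nonneg zero_le_three]; linarith)
      linarith
    subst hb
    have hlin : ∀ x : EuclideanSpace ℝ (Fin 6), ‖x‖ = 1 → h 1 • gradMapF x = ht 1 • R x := by
      intro x hx
      have hx0 : x ≠ 0 := norm_ne_zero_iff.1 (by simp [hx])
      have := hR x hx0
      rw [hu x hx0] at this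
      simpa [hx] using this
    have q₀ := hlin (EuclideanSpace.single 0 1) (by simp)
    have q₄ := hlin (EuclideanSpace.single 4 1) (by simp)
    have q := hlin ((3 / 5 : ℝ) • EuclideanSpace.single 0 1 +
      (4 / 5 : ℝ) • EuclideanSpace.single 4 1) (by
        rw [← pow_left_inj₀ (norm_nonneg _) zero_le_one two_ne_zero,
          norm_sq_eq_normSqX_add_normSqY]
        simp [normSqX, normSqY]
        norm_num)
    rw [map_add, map_smul, map_smul, smul_add, smul_comm (ht 1), smul_comm (ht 1), ← q₀, ← q₄] at q
    have q' := congrArg (fun z : EuclideanSpace ℝ (Fin 6) => z 0) q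
    simp [gradMapF_eq, normSqX, normSqY, innXY] at q'
    have := hpos 1 one_pos
    norm_num at q'
    linarith
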